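/- Let a ∈ ℝ and c > 0. There is no differentiable function H : (−∞,a) → ℝ such that H(t) > 0 for all t, H(t) → 0 as t → −∞, and H'(t)/√(H(t)) → c as t → −∞. -/

import Mathlib

open Filter Set

/-- **The analytic contradiction in case (c) of the `A < 0` analysis.**  For `c > 0`
there is no differentiable `H : (-∞,a) → ℝ` with `H > 0`, `H(t) → 0` as `t → -∞`,
and `H'(t)/√(H(t)) → c` as `t → -∞`. -/
theorem no_sqrt_asymptotics_at_bot
    (a c : ℝ) (hc : 0 < c) :
    ¬ ∃ H H' : ℝ → ℝ,
        (∀ t ∈ Iio a, HasDerivAt H (H' t) t) ∧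
        (∀ t ∈ Iio a, 0 < H t) ∧
        Tendsto H atBot (nhds 0) ∧
        Tendsto (fun t => H' t / Real.sqrt (H t)) atBot (nhds c) := by
  rintro ⟨H, H', hd, hpos, -, hlim⟩
  have h1 : ∀ᶠ t in atBot, c / 2 < H' t / Real.sqrt (H t) :=
    hlim.eventually (lt_mem_nhds (by linarith))
  obtain ⟨b, hb⟩ := eventually_atBot.1 (h1.and (eventually_lt_atBot a))
  have hG : ∀ t, t ≤ b →
      HasDerivAt (fun s => Real.sqrt (H s)) (H' t / (2 * Real.sqrt (H t))) t := by
    intro t ht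
    have hta := (hb t ht).2
    exact (hd t hta).sqrt (hpos t hta).ne'
  have hGb : 0 ≤ Real.sqrt (H b) := Real.sqrt_nonneg _
  have hdpos : 0 < 4 * (Real.sqrt (H b) + 1) / c := by positivity
  obtain ⟨x, hx, hxe⟩ := exists_hasDerivAt_eq_slope (fun s => Real.sqrt (H s))
    (fun t => H' t / (2 * Real.sqrt (H t)))
    (show b - 4 * (Real.sqrt (H b) + 1) / c < b by linarith)
    (fun t ht => (hG t ht.2).continuousAt.continuousWithinAt)
    (fun t ht => hG t ht.2.le)
  have h2 := (hb x hx.2.le).1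
  have h3 : H' x / (2 * Real.sqrt (H x)) = (H' x / Real.sqrt (H x)) / 2 := by
    rw [div_div, mul_comm]
  have h4 : c / 4 < H' x / (2 * Real.sqrt (H x)) := by rw [h3]; linarith
  rw [hxe, sub_sub_cancel, lt_div_iff₀ hdpos] at h4
  have h5 : c / 4 * (4 * (Real.sqrt (H b) + 1) / c) = Real.sqrt (H b) + 1 := by
    field_simp
  rw [h5] at h4
  have h6 := Real.sqrt_nonneg (H (b - 4 * (Real.sqrt (H b) + 1) / c))
  linarith
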